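/- (Analytic core of Theorem 3.2.) Assume A_0 > 0, α > κ_0/2, β ∈ (0,1), γ > 0, μ > 0, t > 0. Then lim_{ε→0⁺} ∫_ℝ ( E_β(−μ|λ|^α (1 + λ² ε^{2β/α})^{γ/2} t^β) · ε^{(1−κ_0)β/(2α)} √(f(ε^{β/α} λ)) − √(A_0/(2 Γ(κ_0) cos(πκ_0/2))) · E_β(−μ t^β |λ|^α) |λ|^{(κ_0−1)/2} )² dλ = 0. (This integral is the mean-square distance E(U_ε(t,x) − U_0(t,x))² between the rescaled solution of the fractional Riesz–Bessel equation and the limit Gaussian field; its vanishing yields the convergence of finite-dimensional distributions.) -/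

import Mathlib

open Real Filter Topology MeasureTheory

/-- The modified Bessel function of the second kind
`K_ν(z) = (1/2) ∫_0^∞ s^{ν−1} exp(−(z/2)(s + 1/s)) ds`. -/
noncomputable def besselK (ν z : ℝ) : ℝ :=
  (1 / 2) * ∫ s in Set.Ioi (0 : ℝ), s ^ (ν - 1) * Real.exp (-(z / 2) * (s + 1 / s))

/-- The spectral density
`f(λ) = (c_1(κ_0)/2) A_0 K_{(κ_0−1)/2}(|λ|)|λ|^{(κ_0−1)/2}
  + ∑_{j=1}^n (c_1(κ_j)/2) A_j (K_{(κ_j−1)/2}(|λ+w_j|)|λ+w_j|^{(κ_j−1)/2}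
                              + K_{(κ_j−1)/2}(|λ−w_j|)|λ−w_j|^{(κ_j−1)/2})`,
with `c_1(κ_0) = 2·2^{(1−κ_0)/2}/(√π Γ(κ_0/2))` and
`c_1(κ_j) = 2^{(1−κ_j)/2}/(√π Γ(κ_j/2))` for `j ≥ 1`. -/
noncomputable def specDensity (n : ℕ) (w κ A : ℕ → ℝ) (lam : ℝ) : ℝ :=
  2 * (2 : ℝ) ^ ((1 - κ 0) / 2) / (Real.sqrt Real.pi * Real.Gamma (κ 0 / 2)) / 2 * A 0 *
      besselK ((κ 0 - 1) / 2) |lam| * |lam| ^ ((κ 0 - 1) / 2) +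
    ∑ j ∈ Finset.Icc 1 n,
      (2 : ℝ) ^ ((1 - κ j) / 2) / (Real.sqrt Real.pi * Real.Gamma (κ j / 2)) / 2 * A j *
        (besselK ((κ j - 1) / 2) |lam + w j| * |lam + w j| ^ ((κ j - 1) / 2) +
          besselK ((κ j - 1) / 2) |lam - w j| * |lam - w j| ^ ((κ j - 1) / 2))

/-- The Mittag-Leffler function `E_β(s) = ∑_{k=0}^∞ s^k / Γ(1 + βk)`. -/
noncomputable def mittagLeffler (β s : ℝ) : ℝ := ∑' k : ℕ, s ^ k / Real.Gamma (1 + β * k)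


/-- Coefficients of `(1-z)^(-c-1)`. -/
noncomputable def ac (c : ℝ) : ℕ → ℝ
  | 0 => 1
  | n + 1 => ac c n * ((c + 1 + n) / (n + 1))

lemma ac_zero (c : ℝ) : ac c 0 = 1 := rfl
lemma ac_succ (c : ℝ) (n : ℕ) : ac c (n + 1) = ac c n * ((c + 1 + n) / (n + 1)) := rfl

lemma ac_succ' (c : ℝ) (n : ℕ) : (n + 1) * ac c (n + 1) = ac c n * (c + 1 + n) := by
  rw [ac_succ]; field_simp

lemma ac_conv (c d : ℝ) (n : ℕ) :
    ∑ p ∈ Finset.HasAntidiagonal.antidiagonal n, ac c p.1 * ac d p.2 = ac (c + d + 1) n := by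
  induction n with
  | zero => simp [ac_zero]
  | succ n ih =>
    have h0 : ((n : ℝ) + 1) ≠ 0 := by positivity
    apply mul_left_cancel₀ h0
    rw [ac_succ', ← ih]
    have h1 : ((n : ℝ) + 1) * ∑ p ∈ Finset.HasAntidiagonal.antidiagonal (n + 1), ac c p.1 * ac d p.2
        = ∑ p ∈ Finset.HasAntidiagonal.antidiagonal (n + 1), ((p.1 : ℝ) * ac c p.1) * ac d p.2
          + ∑ p ∈ Finset.HasAntidiagonal.antidiagonal (n + 1), ac c p.1 * ((p.2 : ℝ) * ac d p.2) := by
      rw [Finset.mul_sum, ← Finset.sum_add_distrib]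
      apply Finset.sum_congr rfl
      intro p hp
      have : ((p.1 : ℝ) + p.2) = n + 1 := by
        have := Finset.HasAntidiagonal.mem_antidiagonal.1 hp
        exact_mod_cast this
      rw [← this]; ring
    rw [h1, Finset.Nat.sum_antidiagonal_succ, Finset.Nat.sum_antidiagonal_succ']
    simp only [Nat.cast_zero, zero_mul, mul_zero, zero_add]
    push_cast
    simp only [ac_succ']
    rw [Finset.sum_mul, ← Finset.sum_add_distrib]
    apply Finset.sum_congr rfl
    intro p hp
    have : ((p.1 : ℝ) + p.2) = n := by
      have := Finset.HasAntidiagonal.mem_antidiagonal.1 hp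
      exact_mod_cast this
    rw [← this]; ring

lemma ac_pos {c : ℝ} (hc : -1 < c) (n : ℕ) : 0 < ac c n := by
  induction n with
  | zero => simp [ac_zero]
  | succ n ih => rw [ac_succ]; have : 0 < c + 1 + n := by
                   have : 0 ≤ (n : ℝ) := by positivity
                   linarith
                 positivity

lemma ac_mono {c d : ℝ} (hc : -1 < c) (hcd : c ≤ d) (n : ℕ) : ac c n ≤ ac d n := by
  induction n with
  | zero => simp [ac_zero]
  | succ n ih =>
    rw [ac_succ, ac_succ]
    have h1 := ac_pos hc n
    have h2 := ac_pos (hc.trans_le hcd) n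
    have : 0 ≤ (n : ℝ) := by positivity
    apply mul_le_mul ih _ (div_nonneg (by linarith) (by linarith)) h2.le
    gcongr

lemma ac_at_zero (n : ℕ) : ac 0 n = 1 := by
  induction n with
  | zero => rfl
  | succ n ih => rw [ac_succ, ih]; field_simp; ring

lemma ac_nat (k n : ℕ) : ac (k : ℝ) n = ((k + n).choose n : ℝ) := by
  induction n with
  | zero => simp [ac_zero]
  | succ n ih =>
    have h0 : ((n : ℝ) + 1) ≠ 0 := by positivity
    apply mul_left_cancel₀ h0
    rw [ac_succ', ih]
    have := Nat.add_one_mul_choose_eq (k + n) n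
    have h2 : ((k + n + 1 : ℕ) : ℝ) * ((k + n).choose n : ℝ) = ((k + n + 1).choose (n + 1) : ℝ) * ((n + 1 : ℕ) : ℝ) := by
      exact_mod_cast this
    push_cast at h2
    rw [← add_assoc k n 1]
    linarith

/-- `b_j = -ac (-β-1) j ≥ 0` for `j ≥ 1`. -/
lemma ac_neg_nonpos {β : ℝ} (h0 : 0 < β) (h1 : β < 1) (n : ℕ) : ac (-β - 1) (n + 1) ≤ 0 := by
  induction n with
  | zero => rw [ac_succ, ac_zero]; norm_num; exact h0.le
  | succ n ih =>
    rw [ac_succ]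
    apply mul_nonpos_of_nonpos_of_nonneg ih
    have : 0 ≤ (n : ℝ) := by positivity
    push_cast
    apply div_nonneg <;> linarith

lemma ac_summable {β lam : ℝ} (hβ : β ∈ Set.Ioo (0 : ℝ) 1) (h0 : 0 ≤ lam) (h1 : lam < 1) (n : ℕ) :
    Summable fun k : ℕ => lam ^ k * ac (β * k) n := by
  have hs := summable_choose_mul_geometric_of_norm_lt_one (R := ℝ) n (r := lam)
    (by rw [Real.norm_eq_abs, abs_of_nonneg h0]; exact h1)
  have hk : ∀ k : ℕ, (-1 : ℝ) < β * k := fun k =>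
    lt_of_lt_of_le (by norm_num) (mul_nonneg hβ.1.le (Nat.cast_nonneg k))
  refine Summable.of_nonneg_of_le (fun k => mul_nonneg (pow_nonneg h0 k) (ac_pos (hk k) n).le)
    (fun k => ?_) hs
  rw [mul_comm, ← ac_nat]
  gcongr
  exact ac_mono (hk k) (mul_le_of_le_one_left (Nat.cast_nonneg k) hβ.2.le) n

noncomputable def acU (β lam : ℝ) (n : ℕ) : ℝ := ∑' k : ℕ, (-lam) ^ k * ac (β * k) n

lemma ac_summable' {β lam : ℝ} (hβ : β ∈ Set.Ioo (0 : ℝ) 1) (h0 : 0 ≤ lam) (h1 : lam < 1) (n : ℕ) :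
    Summable fun k : ℕ => (-lam) ^ k * ac (β * k) n := by
  refine Summable.of_norm_bounded (ac_summable hβ h0 h1 n) (fun k => ?_)
  have hk : (-1 : ℝ) < β * k :=
    lt_of_lt_of_le (by norm_num) (mul_nonneg hβ.1.le (Nat.cast_nonneg k))
  rw [norm_mul, norm_pow, norm_neg, Real.norm_eq_abs, Real.norm_eq_abs, abs_of_nonneg h0,
    abs_of_pos (ac_pos hk n)]

lemma acU_conv {β lam : ℝ} (hβ : β ∈ Set.Ioo (0 : ℝ) 1) (h0 : 0 ≤ lam) (h1 : lam < 1) (c : ℝ)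
    (n : ℕ) : HasSum (fun k : ℕ => (-lam) ^ k * ac (c + β * k + 1) n)
      (∑ p ∈ Finset.HasAntidiagonal.antidiagonal n, ac c p.1 * acU β lam p.2) := by
  have : (fun k : ℕ => (-lam) ^ k * ac (c + β * k + 1) n) = fun k : ℕ =>
      ∑ p ∈ Finset.HasAntidiagonal.antidiagonal n, ac c p.1 * ((-lam) ^ k * ac (β * k) p.2) := by
    ext k
    rw [← ac_conv, Finset.mul_sum]
    exact Finset.sum_congr rfl fun p _ => by ring
  rw [this]
  apply hasSum_sum
  intro p _
  exact (ac_summable' hβ h0 h1 p.2).hasSum.mul_left _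

lemma acU_rec1 {β lam : ℝ} (hβ : β ∈ Set.Ioo (0 : ℝ) 1) (h0 : 0 ≤ lam) (h1 : lam < 1) (n : ℕ) :
    ∑ p ∈ Finset.HasAntidiagonal.antidiagonal n, ac (-β - 1) p.1 * acU β lam p.2
      = ac (-β) n - lam * acU β lam n := by
  refine (acU_conv hβ h0 h1 (-β - 1) n).unique ?_
  rw [← hasSum_nat_add_iff' 1]
  convert! (ac_summable' hβ h0 h1 n).hasSum.mul_left (-lam) using 1
  · ext k
    push_cast
    rw [show -β - 1 + β * ((k : ℝ) + 1) + 1 = β * k by ring]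
    ring
  · simp [acU]

lemma acU_rec2 {β lam : ℝ} (hβ : β ∈ Set.Ioo (0 : ℝ) 1) (h0 : 0 ≤ lam) (h1 : lam < 1) (n : ℕ) :
    lam * ∑ p ∈ Finset.HasAntidiagonal.antidiagonal n, ac (β - 1) p.1 * acU β lam p.2
      = 1 - acU β lam n := by
  have h := (acU_conv hβ h0 h1 (β - 1) n).mul_left (-lam)
  have h2 := (hasSum_nat_add_iff' 1).2 (ac_summable' hβ h0 h1 n).hasSum
  have h3 := h.unique (a₂ := acU β lam n - 1) (by
    convert! h2 using 1
    · ext k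
      push_cast
      rw [show β - 1 + β * (k : ℝ) + 1 = β * (k + 1) by ring]
      ring
    · simp [acU, ac_at_zero])
  linarith

lemma ac_pascal_aux (c : ℝ) (n : ℕ) : (n + 1) * ac (c - 1) (n + 1) = c * ac c n := by
  induction n with
  | zero => simp [ac_succ, ac_zero]
  | succ n ih =>
    rw [ac_succ' (c - 1) (n + 1), ac_succ c n]
    push_cast
    field_simp
    linear_combination (c - 1 + 1 + (n + 1)) * ih

lemma ac_pascal (c : ℝ) (n : ℕ) : ac c (n + 1) - ac c n = ac (c - 1) (n + 1) := by
  have h0 : ((n : ℝ) + 1) ≠ 0 := by positivity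
  apply mul_left_cancel₀ h0
  rw [ac_pascal_aux, mul_sub, ac_succ']; ring

lemma acU_step {β lam : ℝ} (hβ : β ∈ Set.Ioo (0 : ℝ) 1) (h0 : 0 ≤ lam) (h1 : lam < 1) (n : ℕ) :
    (1 + lam) * acU β lam (n + 1) = ac (-β) (n + 1) -
      ∑ p ∈ Finset.HasAntidiagonal.antidiagonal n, ac (-β - 1) (p.1 + 1) * acU β lam p.2 := by
  have h := acU_rec1 hβ h0 h1 (n + 1)
  rw [Finset.Nat.sum_antidiagonal_succ, ac_zero] at h
  linarith

lemma acU_first {β lam : ℝ} (hβ : β ∈ Set.Ioo (0 : ℝ) 1) (h0 : 0 ≤ lam) (h1 : lam < 1) :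
    (1 + lam) * acU β lam 0 = 1 := by
  have h := acU_rec1 hβ h0 h1 0
  simp [ac_zero] at h
  linarith

lemma acU_nonneg {β lam : ℝ} (hβ : β ∈ Set.Ioo (0 : ℝ) 1) (h0 : 0 ≤ lam) (h1 : lam < 1) (n : ℕ) :
    0 ≤ acU β lam n := by
  induction n using Nat.strong_induction_on with
  | _ n ih =>
    have hl : 0 < 1 + lam := by linarith
    refine le_of_mul_le_mul_left (a := 1 + lam) ?_ hl
    rw [mul_zero]
    cases n with
    | zero => rw [acU_first hβ h0 h1]; norm_num
    | succ n =>
      rw [acU_step hβ h0 h1]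
      have h2 := ac_pos (c := -β) (by linarith [hβ.2]) (n + 1)
      have h3 : ∑ p ∈ Finset.HasAntidiagonal.antidiagonal n,
          ac (-β - 1) (p.1 + 1) * acU β lam p.2 ≤ 0 := by
        apply Finset.sum_nonpos
        intro p hp
        have hp' := Finset.HasAntidiagonal.mem_antidiagonal.1 hp
        exact mul_nonpos_of_nonpos_of_nonneg (ac_neg_nonpos hβ.1 hβ.2 _) (ih _ (by omega))
      linarith

lemma acU_anti_step {β lam : ℝ} (hβ : β ∈ Set.Ioo (0 : ℝ) 1) (h0 : 0 ≤ lam) (h1 : lam < 1)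
    (n : ℕ) : acU β lam (n + 1) - acU β lam n ≤ 0 := by
  have hl : 0 < 1 + lam := by linarith
  have hU0 : acU β lam 0 ≤ 1 := by
    have := acU_first hβ h0 h1
    have := acU_nonneg hβ h0 h1 0
    nlinarith
  induction n using Nat.strong_induction_on with
  | _ n ih =>
    refine le_of_mul_le_mul_left (a := 1 + lam) ?_ hl
    rw [mul_zero, mul_sub]
    have h5 := ac_neg_nonpos hβ.1 hβ.2 n
    cases n with
    | zero =>
      rw [acU_first hβ h0 h1, acU_step hβ h0 h1]
      have := ac_pascal (-β) 0
      simp [ac_zero] at this ⊢ h5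
      nlinarith
    | succ n =>
      rw [acU_step hβ h0 h1, acU_step hβ h0 h1, Finset.Nat.sum_antidiagonal_succ']
      have h2 := ac_pascal (-β) (n + 1)
      have h3 : 0 ≤ ∑ p ∈ Finset.HasAntidiagonal.antidiagonal n,
          ac (-β - 1) (p.1 + 1) * (acU β lam (p.2 + 1) - acU β lam p.2) := by
        apply Finset.sum_nonneg
        intro p hp
        have hp' := Finset.HasAntidiagonal.mem_antidiagonal.1 hp
        exact mul_nonneg_of_nonpos_of_nonpos (ac_neg_nonpos hβ.1 hβ.2 _) (ih _ (by omega))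
      simp only [mul_sub, Finset.sum_sub_distrib] at h3
      simp only
      nlinarith

lemma acU_anti {β lam : ℝ} (hβ : β ∈ Set.Ioo (0 : ℝ) 1) (h0 : 0 ≤ lam) (h1 : lam < 1) :
    Antitone (acU β lam) :=
  antitone_nat_of_succ_le fun n => by linarith [acU_anti_step hβ h0 h1 n]

lemma acU_bound {β lam : ℝ} (hβ : β ∈ Set.Ioo (0 : ℝ) 1) (h0 : 0 ≤ lam) (h1 : lam < 1) (n : ℕ) :
    acU β lam n * (1 + lam * ac β n) ≤ 1 := by
  have h := acU_rec2 hβ h0 h1 n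
  have h2 : ac β n * acU β lam n ≤
      ∑ p ∈ Finset.HasAntidiagonal.antidiagonal n, ac (β - 1) p.1 * acU β lam p.2 := by
    have h3 := ac_conv (β - 1) 0 n
    rw [show β - 1 + 0 + 1 = β by ring] at h3
    rw [← h3, Finset.sum_mul]
    apply Finset.sum_le_sum
    intro p hp
    have hp' := Finset.HasAntidiagonal.mem_antidiagonal.1 hp
    rw [ac_at_zero, mul_one]
    exact mul_le_mul_of_nonneg_left (acU_anti hβ h0 h1 (by omega))
      (ac_pos (by linarith [hβ.1]) _).le
  have := mul_le_mul_of_nonneg_left h2 h0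
  linarith

lemma ac_ratio_step {c : ℝ} (hc : 0 ≤ c) (n : ℕ) (hn : 1 ≤ n) :
    ac c (n + 1) / ((n + 1 : ℕ) : ℝ) ^ c ≤ ac c n / (n : ℝ) ^ c := by
  have hn' : (0 : ℝ) < n := by exact_mod_cast hn
  have hp := ac_pos (c := c) (by linarith) n
  have hn1 : (0 : ℝ) < (n : ℝ) ^ c := Real.rpow_pos_of_pos hn' c
  have hn2 : (0 : ℝ) < ((n + 1 : ℕ) : ℝ) ^ c := Real.rpow_pos_of_pos (by positivity) c
  rw [div_le_div_iff₀ hn2 hn1, ac_succ, mul_assoc]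
  refine mul_le_mul_of_nonneg_left ?_ hp.le
  push_cast
  rcases le_total 1 c with h | h
  · have hb := one_add_mul_self_le_rpow_one_add (s := 1 / (n : ℝ)) (by
      have : 0 ≤ 1 / (n : ℝ) := by positivity
      linarith) h
    have e : (1 + 1 / (n : ℝ)) ^ c * (n : ℝ) ^ c = ((n : ℝ) + 1) ^ c := by
      rw [← Real.mul_rpow (by positivity) (by positivity)]
      congr 1; field_simp
    rw [← e]
    refine mul_le_mul_of_nonneg_right (le_trans ?_ hb) hn1.le
    have : (c + 1 + n) / ((n : ℝ) + 1) = 1 + c / (n + 1) := by field_simp; ring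
    rw [this, mul_one_div]
    gcongr
    linarith
  · have hb := rpow_one_add_le_one_add_mul_self (s := -(1 / ((n : ℝ) + 1))) (by
      have : 1 / ((n : ℝ) + 1) ≤ 1 := by rw [div_le_one (by positivity)]; linarith
      linarith) hc h
    have e : (n : ℝ) ^ c = (1 + -(1 / ((n : ℝ) + 1))) ^ c * ((n : ℝ) + 1) ^ c := by
      have : 0 ≤ 1 + -(1 / ((n : ℝ) + 1)) := by
        have : 1 / ((n : ℝ) + 1) ≤ 1 := by rw [div_le_one (by positivity)]; linarith
        linarith
      rw [← Real.mul_rpow this (by positivity)]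
      congr 1; field_simp; ring
    rw [e, ← mul_assoc]
    have hn3 : (0 : ℝ) < ((n : ℝ) + 1) ^ c := Real.rpow_pos_of_pos (by positivity) c
    refine mul_le_of_le_one_left hn3.le ?_
    have : (c + 1 + n) / ((n : ℝ) + 1) = 1 + c / (n + 1) := by field_simp; ring
    rw [this]
    have h4 : 0 ≤ c / ((n : ℝ) + 1) := by positivity
    calc (1 + c / ((n : ℝ) + 1)) * (1 + -(1 / ((n : ℝ) + 1))) ^ c
        ≤ (1 + c / ((n : ℝ) + 1)) * (1 + c * -(1 / ((n : ℝ) + 1))) := by gcongr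
      _ = 1 - (c / ((n : ℝ) + 1)) ^ 2 := by ring
      _ ≤ 1 := by nlinarith [sq_nonneg (c / ((n : ℝ) + 1))]

lemma ac_ratio_anti {c : ℝ} (hc : 0 ≤ c) {N n : ℕ} (hN : 1 ≤ N) (h : N ≤ n) :
    ac c n / (n : ℝ) ^ c ≤ ac c N / (N : ℝ) ^ c := by
  induction n, h using Nat.le_induction with
  | base => exact le_rfl
  | succ n hn ih => exact (ac_ratio_step hc n (hN.trans hn)).trans ih

lemma ac_prod (c : ℝ) (n : ℕ) :
    ∏ j ∈ Finset.range (n + 1), (c + j) = c * (n.factorial : ℝ) * ac c n := by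
  induction n with
  | zero => simp [ac_zero]
  | succ n ih =>
    rw [Finset.prod_range_succ, ih, Nat.factorial_succ]
    push_cast
    have := ac_succ' c n
    linear_combination (-c * (n.factorial : ℝ)) * this

lemma ac_tendsto {c : ℝ} (hc : 0 ≤ c) :
    Tendsto (fun n : ℕ => ac c n / (n : ℝ) ^ c) atTop (𝓝 (1 / Real.Gamma (1 + c))) := by
  rcases hc.eq_or_lt with rfl | hc
  · simp [ac_at_zero]
  have h := Real.GammaSeq_tendsto_Gamma c
  have hG := Real.Gamma_pos_of_pos hc
  have h2 := (h.const_mul c).inv₀ (by positivity)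
  rw [one_div, add_comm, Real.Gamma_add_one hc.ne']
  refine h2.congr fun n => ?_
  have h1 := ac_pos (c := c) (by linarith) n
  have : (n.factorial : ℝ) ≠ 0 := by positivity
  rw [Real.GammaSeq, ac_prod]
  have hq : c * ((n : ℝ) ^ c * (n.factorial : ℝ) / (c * (n.factorial : ℝ) * ac c n))
      = (n : ℝ) ^ c / ac c n := by field_simp
  rw [hq, inv_div]

lemma ml_exists_N {β : ℝ} (hβ : 0 < β) (x : ℝ) :
    ∃ N : ℕ, 1 ≤ N ∧ ∀ n : ℕ, N ≤ n → x / (n : ℝ) ^ β < 1 := by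
  have h : Tendsto (fun n : ℕ => (n : ℝ) ^ β) atTop atTop :=
    (tendsto_rpow_atTop hβ).comp tendsto_natCast_atTop_atTop
  obtain ⟨N, hN⟩ := (h.eventually_gt_atTop (max x 0)).exists_forall_of_atTop
  refine ⟨N + 1, by omega, fun n hn => ?_⟩
  have := hN n (by omega)
  rw [div_lt_one ((le_max_right x 0).trans_lt this)]
  exact (le_max_left x 0).trans_lt this

lemma ml_pow_eq {β x : ℝ} (n k : ℕ) :
    (x / (n : ℝ) ^ β) ^ k * ac (β * k) n = x ^ k * (ac (β * k) n / (n : ℝ) ^ (β * k)) := by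
  rw [div_pow, Real.rpow_mul (Nat.cast_nonneg n), Real.rpow_natCast]
  ring

lemma ml_nonneg_index {β : ℝ} (hβ : 0 < β) (k : ℕ) : 0 ≤ β * k :=
  mul_nonneg hβ.le (Nat.cast_nonneg k)

lemma ml_summable {β : ℝ} (hβ : β ∈ Set.Ioo (0 : ℝ) 1) {x : ℝ} (hx : 0 ≤ x) :
    Summable fun k : ℕ => x ^ k / Real.Gamma (1 + β * k) := by
  obtain ⟨N, hN1, hN⟩ := ml_exists_N hβ.1 x
  have hs := ac_summable hβ (lam := x / (N : ℝ) ^ β) (by positivity) (hN N le_rfl) N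
  have hk := fun k => ml_nonneg_index hβ.1 k
  refine Summable.of_nonneg_of_le (fun k => ?_) (fun k => ?_) hs
  · have := Real.Gamma_pos_of_pos (s := 1 + β * k) (by linarith [hk k])
    positivity
  · rw [ml_pow_eq, div_eq_mul_one_div]
    refine mul_le_mul_of_nonneg_left ?_ (pow_nonneg hx k)
    refine le_of_tendsto (ac_tendsto (hk k)) ?_
    filter_upwards [eventually_ge_atTop N] with n hn
    exact ac_ratio_anti (hk k) hN1 hn

lemma ml_tendsto {β : ℝ} (hβ : β ∈ Set.Ioo (0 : ℝ) 1) {x : ℝ} (hx : 0 ≤ x) :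
    Tendsto (fun n : ℕ => acU β (x / (n : ℝ) ^ β) n) atTop (𝓝 (mittagLeffler β (-x))) := by
  obtain ⟨N, hN1, hN⟩ := ml_exists_N hβ.1 x
  have hs := ac_summable hβ (lam := x / (N : ℝ) ^ β) (by positivity) (hN N le_rfl) N
  have hk := fun k => ml_nonneg_index hβ.1 k
  unfold acU mittagLeffler
  refine tendsto_tsum_of_dominated_convergence hs (fun k => ?_) ?_
  · have h := (ac_tendsto (hk k)).const_mul ((-x) ^ k)
    rw [← div_eq_mul_one_div] at h
    refine h.congr fun n => ?_
    rw [← ml_pow_eq, neg_div]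
  · filter_upwards [eventually_ge_atTop N] with n hn k
    have hp := ac_pos (c := β * k) (by linarith [hk k]) n
    rw [norm_mul, norm_pow, norm_neg, Real.norm_eq_abs, Real.norm_eq_abs, abs_of_pos hp,
      abs_of_nonneg (by positivity), ml_pow_eq, ml_pow_eq]
    exact mul_le_mul_of_nonneg_left (ac_ratio_anti (hk k) hN1 hn) (pow_nonneg hx k)

lemma ml_nonneg {β : ℝ} (hβ : β ∈ Set.Ioo (0 : ℝ) 1) {x : ℝ} (hx : 0 ≤ x) :
    0 ≤ mittagLeffler β (-x) := by
  obtain ⟨N, hN1, hN⟩ := ml_exists_N hβ.1 x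
  refine ge_of_tendsto (ml_tendsto hβ hx) ?_
  filter_upwards [eventually_ge_atTop N] with n hn
  exact acU_nonneg hβ (by positivity) (hN n hn) n

lemma ml_bound {β : ℝ} (hβ : β ∈ Set.Ioo (0 : ℝ) 1) {x : ℝ} (hx : 0 ≤ x) :
    mittagLeffler β (-x) * (1 + x / Real.Gamma (1 + β)) ≤ 1 := by
  obtain ⟨N, hN1, hN⟩ := ml_exists_N hβ.1 x
  have h2 := ((ac_tendsto hβ.1.le).const_mul x).const_add 1
  have h3 := (ml_tendsto hβ hx).mul h2
  rw [← div_eq_mul_one_div] at h3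
  refine le_of_tendsto h3 ?_
  filter_upwards [eventually_ge_atTop N] with n hn
  have := acU_bound hβ (lam := x / (n : ℝ) ^ β) (by positivity) (hN n hn) n
  rwa [div_mul_eq_mul_div, mul_div_assoc] at this

lemma ml_continuous {β : ℝ} (hβ : β ∈ Set.Ioo (0 : ℝ) 1) : Continuous (mittagLeffler β) := by
  rw [continuous_iff_continuousAt]
  intro s
  have hR : 0 ≤ |s| + 1 := by positivity
  have h : ContinuousOn (mittagLeffler β) (Metric.ball 0 (|s| + 1)) := by
    unfold mittagLeffler
    refine continuousOn_tsum (fun k => ?_) (ml_summable hβ hR) (fun k y hy => ?_)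
    · exact ((continuous_id.pow k).div_const _).continuousOn
    · have := Real.Gamma_pos_of_pos (s := 1 + β * k) (by linarith [ml_nonneg_index hβ.1 k])
      rw [norm_div, norm_pow, Real.norm_of_nonneg this.le]
      have hy' : ‖y‖ ≤ |s| + 1 := by simpa using (mem_ball_zero_iff.1 hy).le
      gcongr
  refine h.continuousAt (Metric.isOpen_ball.mem_nhds ?_)
  simp

/-- Comparison function for integrability. -/
noncomputable def bnd (a b v : ℝ) : ℝ := if |v| ≤ 1 then |v| ^ a else |v| ^ b

lemma bnd_integrable {a b : ℝ} (ha : -1 < a) (hb : b < -1) : Integrable (bnd a b) := by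
  have h1 : IntegrableOn (bnd a b) (Set.Ioi 0) := by
    rw [← Set.Ioc_union_Ioi_eq_Ioi (zero_le_one' ℝ), integrableOn_union]
    constructor
    · have := (intervalIntegral.intervalIntegrable_rpow' (a := 0) (b := 1) ha)
      rw [intervalIntegrable_iff_integrableOn_Ioc_of_le zero_le_one] at this
      refine this.congr_fun (fun x hx => ?_) measurableSet_Ioc
      simp [bnd, abs_of_pos hx.1, hx.2]
    · refine (integrableOn_Ioi_rpow_of_lt hb one_pos).congr_fun (fun x hx => ?_) measurableSet_Ioi
      have hx' : (1 : ℝ) < x := hx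
      simp [bnd, abs_of_pos (one_pos.trans hx'), hx']
  have h2 := (integrable_indicator_iff measurableSet_Ioi).2 h1
  refine (h2.add h2.comp_neg).congr ?_
  have h0 : ∀ᵐ x : ℝ, x ≠ 0 := by simp [ae_iff, measure_singleton]
  filter_upwards [h0] with x hx
  rcases lt_or_gt_of_ne hx with h | h
  · have h' : ¬ (0 < x) := not_lt.2 h.le
    simp [Set.indicator, h, h', bnd]
  · have h' : ¬ (x < 0) := not_lt.2 h.le
    simp [Set.indicator, h, h']

/-- `G_p(z) = ∫_0^∞ e^{-y} y^{p-1} e^{-z²/(4 y)} dy`. -/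
noncomputable def GK (p z : ℝ) : ℝ :=
  ∫ y in Set.Ioi (0 : ℝ), Real.exp (-y) * y ^ (p - 1) * Real.exp (-(z ^ 2 / (4 * y)))

lemma GK_zero {p : ℝ} (hp : 0 < p) : GK p 0 = Real.Gamma p := by
  simp [GK, Real.Gamma_eq_integral hp]

lemma GK_nonneg (p z : ℝ) : 0 ≤ GK p z := by
  refine setIntegral_nonneg measurableSet_Ioi fun y hy => ?_
  have : (0 : ℝ) < y := hy
  positivity

lemma GK_le {p : ℝ} (hp : 0 < p) (z : ℝ) : GK p z ≤ Real.Gamma p := by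
  rw [Real.Gamma_eq_integral hp]
  refine integral_mono_of_nonneg ?_ (Real.GammaIntegral_convergent hp) ?_
  · filter_upwards [ae_restrict_mem measurableSet_Ioi] with y hy
    have : (0 : ℝ) < y := hy
    simp only [Pi.zero_apply]
    positivity
  · filter_upwards [ae_restrict_mem measurableSet_Ioi] with y hy
    have : (0 : ℝ) < y := hy
    refine mul_le_of_le_one_right (by positivity) (Real.exp_le_one_iff.2 ?_)
    have : 0 ≤ z ^ 2 / (4 * y) := by positivity
    linarith

lemma GK_decay {p : ℝ} (hp : 0 < p) {z : ℝ} (hz : z ≠ 0) :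
    GK p z ≤ 4 * Real.Gamma (p + 1) / z ^ 2 := by
  have hz2 : 0 < z ^ 2 := by positivity
  rw [Real.Gamma_eq_integral (by linarith), mul_div_right_comm, ← integral_const_mul]
  refine integral_mono_of_nonneg ?_ ((Real.GammaIntegral_convergent (by linarith)).const_mul _) ?_
  · filter_upwards [ae_restrict_mem measurableSet_Ioi] with y hy
    have : (0 : ℝ) < y := hy
    simp only [Pi.zero_apply]
    positivity
  · filter_upwards [ae_restrict_mem measurableSet_Ioi] with y hy
    have hy' : (0 : ℝ) < y := hy
    have hq : 0 < z ^ 2 / (4 * y) := by positivity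
    have h1 : Real.exp (-(z ^ 2 / (4 * y))) ≤ 4 * y / z ^ 2 := by
      rw [Real.exp_neg, ← inv_div (z ^ 2)]
      apply inv_anti₀ hq
      linarith [Real.add_one_le_exp (z ^ 2 / (4 * y))]
    have h2 : y ^ (p + 1 - 1) = y ^ (p - 1) * y := by
      rw [← Real.rpow_add_one hy'.ne']; congr 1; ring
    rw [h2]
    calc Real.exp (-y) * y ^ (p - 1) * Real.exp (-(z ^ 2 / (4 * y)))
        ≤ Real.exp (-y) * y ^ (p - 1) * (4 * y / z ^ 2) := by gcongr
      _ = _ := by ring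

lemma GK_continuous {p : ℝ} (hp : 0 < p) : Continuous (GK p) := by
  unfold GK
  refine continuous_of_dominated (bound := fun y => Real.exp (-y) * y ^ (p - 1)) ?_ ?_
    (Real.GammaIntegral_convergent hp) ?_
  · intro z
    exact (by fun_prop : Measurable fun y : ℝ =>
      Real.exp (-y) * y ^ (p - 1) * Real.exp (-(z ^ 2 / (4 * y)))).aestronglyMeasurable
  · intro z
    filter_upwards [ae_restrict_mem measurableSet_Ioi] with y hy
    have : (0 : ℝ) < y := hy
    rw [Real.norm_of_nonneg (by positivity)]
    refine mul_le_of_le_one_right (by positivity) (Real.exp_le_one_iff.2 ?_)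
    have : 0 ≤ z ^ 2 / (4 * y) := by positivity
    linarith
  · filter_upwards with y
    fun_prop

lemma besselK_eq {p z : ℝ} (hz : 0 < z) :
    besselK (-p) z = 1 / 2 * ((z / 2) ^ (-p) * GK p z) := by
  have hz2 : 0 < z / 2 := by positivity
  unfold besselK GK
  congr 1
  have h1 := integral_comp_mul_left_Ioi
    (fun s : ℝ => s ^ (-p - 1) * Real.exp (-(z / 2) * (s + 1 / s))) 0 hz2
  have h2 := integral_comp_rpow_Ioi (fun r : ℝ => (z / 2 * r) ^ (-p - 1) *
    Real.exp (-(z / 2) * (z / 2 * r + 1 / (z / 2 * r)))) (p := -1) (by norm_num)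
  rw [mul_zero, ← h2, smul_eq_mul, eq_comm, inv_mul_eq_iff_eq_mul₀ hz2.ne'] at h1
  rw [h1, ← integral_const_mul, ← integral_const_mul]
  refine setIntegral_congr_fun measurableSet_Ioi fun y hy => ?_
  have hy' : (0 : ℝ) < y := hy
  simp only [smul_eq_mul, Real.rpow_neg_one]
  have e1 : -(z / 2) * (z / 2 * y⁻¹ + 1 / (z / 2 * y⁻¹)) = -y + -(z ^ 2 / (4 * y)) := by
    field_simp; ring
  rw [e1, Real.exp_add, Real.mul_rpow hz2.le (by positivity), Real.inv_rpow hy'.le,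
    ← Real.rpow_neg hy'.le, Real.rpow_sub_one hz2.ne' (-p)]
  have e2 : y ^ (-(-p - 1)) = y ^ (p - 1) * y ^ (2 : ℝ) := by
    rw [← Real.rpow_add hy']; congr 1; ring
  have e3 : y ^ ((-1 : ℝ) - 1) * y ^ (2 : ℝ) = 1 := by
    rw [← Real.rpow_add hy']; norm_num
  rw [e2, abs_neg, abs_one, one_mul]
  calc _ = (y ^ ((-1 : ℝ) - 1) * y ^ (2 : ℝ)) * ((z / 2) ^ (-p) * (Real.exp (-y) * y ^ (p - 1)
        * Real.exp (-(z ^ 2 / (4 * y))))) := by field_simp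
    _ = _ := by rw [e3, one_mul]

/-- The basic term. -/
noncomputable def gK (κ v : ℝ) : ℝ := |v| ^ (κ - 1) * GK ((1 - κ) / 2) |v|

lemma bessel_term {κ : ℝ} (hκ : κ ∈ Set.Ioo (0 : ℝ) 1) (v : ℝ) :
    besselK ((κ - 1) / 2) |v| * |v| ^ ((κ - 1) / 2)
      = (2 : ℝ) ^ ((1 - κ) / 2) / 2 * gK κ v := by
  have h1 : κ - 1 ≠ 0 := by linarith [hκ.2]
  unfold gK
  rcases eq_or_ne v 0 with rfl | hv
  · simp [Real.zero_rpow h1, Real.zero_rpow (div_ne_zero h1 two_ne_zero)]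
  · have hv' := abs_pos.2 hv
    have e : (κ - 1) / 2 = -((1 - κ) / 2) := by ring
    rw [e, besselK_eq hv', Real.div_rpow hv'.le (by norm_num), Real.rpow_neg zero_le_two]
    have e2 : |v| ^ (κ - 1) = |v| ^ (-((1 - κ) / 2)) * |v| ^ (-((1 - κ) / 2)) := by
      rw [← Real.rpow_add hv']; congr 1; ring
    rw [e2]
    have : (0 : ℝ) < 2 ^ ((1 - κ) / 2) := by positivity
    field_simp

lemma gK_nonneg (κ v : ℝ) : 0 ≤ gK κ v :=
  mul_nonneg (Real.rpow_nonneg (abs_nonneg v) _) (GK_nonneg _ _)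

lemma gK_measurable {κ : ℝ} (hκ : κ ∈ Set.Ioo (0 : ℝ) 1) : Measurable (gK κ) := by
  have := (GK_continuous (p := (1 - κ) / 2) (by linarith [hκ.2])).measurable
  unfold gK
  fun_prop

lemma gK_integrable {κ : ℝ} (hκ : κ ∈ Set.Ioo (0 : ℝ) 1) : Integrable (gK κ) := by
  have hp : 0 < (1 - κ) / 2 := by linarith [hκ.2]
  have hG := Real.Gamma_pos_of_pos hp
  have hG' := Real.Gamma_pos_of_pos (s := (1 - κ) / 2 + 1) (by linarith)
  refine ((bnd_integrable (a := κ - 1) (b := κ - 1 - 2) (by linarith [hκ.1])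
    (by linarith [hκ.2])).const_mul (Real.Gamma ((1 - κ) / 2) + 4 * Real.Gamma ((1 - κ) / 2 + 1))).mono'
    (gK_measurable hκ).aestronglyMeasurable (ae_of_all _ fun v => ?_)
  rw [Real.norm_of_nonneg (gK_nonneg κ v)]
  unfold gK bnd
  have hr : 0 ≤ |v| ^ (κ - 1) := by positivity
  split_ifs with h
  · have := GK_le hp |v|
    rw [mul_comm]
    gcongr
    linarith
  · have hv : 0 < |v| := by linarith
    have := GK_decay hp hv.ne'
    rw [Real.rpow_sub hv (κ - 1) 2, Real.rpow_two]
    calc |v| ^ (κ - 1) * GK ((1 - κ) / 2) |v|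
        ≤ |v| ^ (κ - 1) * (4 * Real.Gamma ((1 - κ) / 2 + 1) / |v| ^ 2) := by gcongr
      _ = (4 * Real.Gamma ((1 - κ) / 2 + 1)) * (|v| ^ (κ - 1) / |v| ^ 2) := by ring
      _ ≤ _ := by gcongr; linarith

lemma gK_weighted {κ a w : ℝ} (hκ : κ ∈ Set.Ioo (0 : ℝ) 1) (ha : a ∈ Set.Ioo (0 : ℝ) 1)
    (hw : w ≠ 0) : Integrable fun u => |u| ^ (-a) * gK κ (u + w) := by
  have hw' := abs_pos.2 hw
  have hp : 0 < (1 - κ) / 2 := by linarith [hκ.2]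
  have hG := Real.Gamma_pos_of_pos hp
  set ρ := min (|w| / 2) 1 with hρ
  have hρ0 : 0 < ρ := by positivity
  have hi1 := (bnd_integrable (a := -a) (b := -2) (by linarith [ha.2]) (by norm_num)).const_mul
    ((|w| / 2) ^ (κ - 1) * Real.Gamma ((1 - κ) / 2))
  have hi2 := ((gK_integrable hκ).comp_add_right w).const_mul (ρ ^ (-a))
  have hm := gK_measurable hκ
  refine (hi1.add hi2).mono' (by fun_prop : Measurable fun u => |u| ^ (-a) * gK κ (u + w)).aestronglyMeasurable
    (ae_of_all _ fun u => ?_)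
  have hg := gK_nonneg κ (u + w)
  have hu : 0 ≤ |u| ^ (-a) := by positivity
  rw [Real.norm_of_nonneg (mul_nonneg hu hg)]
  have hb0 : 0 ≤ bnd (-a) (-2) u := by unfold bnd; split_ifs <;> positivity
  simp only [Pi.add_apply]
  rcases lt_or_ge |u| ρ with h | h
  · have h1 : |u| ≤ 1 := h.le.trans (min_le_right _ _)
    have h2 : |u| ≤ |w| / 2 := h.le.trans (min_le_left _ _)
    have h3 : |w| / 2 ≤ |u + w| := by
      have := abs_sub_abs_le_abs_sub w (-u)
      rw [abs_neg, sub_neg_eq_add, add_comm] at this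
      linarith
    have h4 : gK κ (u + w) ≤ (|w| / 2) ^ (κ - 1) * Real.Gamma ((1 - κ) / 2) := by
      unfold gK
      refine mul_le_mul ?_ (GK_le hp _) (GK_nonneg _ _) (by positivity)
      exact Real.rpow_le_rpow_of_nonpos (by positivity) h3 (by linarith [hκ.2])
    have h5 : bnd (-a) (-2) u = |u| ^ (-a) := by simp [bnd, h1]
    rw [h5]
    have : 0 ≤ ρ ^ (-a) * gK κ (u + w) := by positivity
    nlinarith [mul_le_mul_of_nonneg_left h4 hu]
  · have h1 : |u| ^ (-a) ≤ ρ ^ (-a) := Real.rpow_le_rpow_of_nonpos hρ0 h (by linarith [ha.1])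
    have := mul_le_mul_of_nonneg_right h1 hg
    have : 0 ≤ (|w| / 2) ^ (κ - 1) * Real.Gamma ((1 - κ) / 2) * bnd (-a) (-2) u := by positivity
    linarith

lemma const_eq {κ : ℝ} (hκ : κ ∈ Set.Ioo (0 : ℝ) 1) (A : ℝ) :
    2 * (2 : ℝ) ^ ((1 - κ) / 2) / (Real.sqrt Real.pi * Real.Gamma (κ / 2)) / 2 * A *
      ((2 : ℝ) ^ ((1 - κ) / 2) / 2) * Real.Gamma ((1 - κ) / 2)
      = A / (2 * Real.Gamma κ * Real.cos (Real.pi * κ / 2)) := by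
  have h0 := hκ.1
  have h1 := hκ.2
  have d := Real.Gamma_mul_Gamma_add_half (κ / 2)
  have r := Real.Gamma_mul_Gamma_one_sub (κ / 2 + 1 / 2)
  rw [show Real.pi * (κ / 2 + 1 / 2) = Real.pi * κ / 2 + Real.pi / 2 by ring,
    Real.sin_add_pi_div_two, show 1 - (κ / 2 + 1 / 2) = (1 - κ) / 2 by ring] at r
  rw [show 2 * (κ / 2) = κ by ring] at d
  have hc : 0 < Real.cos (Real.pi * κ / 2) := by
    apply Real.cos_pos_of_mem_Ioo
    constructor <;> nlinarith [Real.pi_pos]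
  have hG1 := Real.Gamma_pos_of_pos (s := κ / 2) (by linarith)
  have hG2 := Real.Gamma_pos_of_pos (s := κ / 2 + 1 / 2) (by linarith)
  have hG3 := Real.Gamma_pos_of_pos (s := (1 - κ) / 2) (by linarith)
  have hG4 := Real.Gamma_pos_of_pos h0
  have e : (2 : ℝ) ^ (1 - κ) = 2 ^ ((1 - κ) / 2) * 2 ^ ((1 - κ) / 2) := by
    rw [← Real.rpow_add two_pos]; congr 1; ring
  have hs : Real.sqrt Real.pi * Real.sqrt Real.pi = Real.pi := Real.mul_self_sqrt Real.pi_pos.le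
  have hsp : 0 < Real.sqrt Real.pi := Real.sqrt_pos.2 Real.pi_pos
  rw [e] at d
  rw [eq_div_iff hc.ne'] at r
  set P := (2 : ℝ) ^ ((1 - κ) / 2)
  set S := Real.sqrt Real.pi
  set C := Real.cos (Real.pi * κ / 2)
  set g1 := Real.Gamma (κ / 2)
  set g2 := Real.Gamma (κ / 2 + 1 / 2)
  set g3 := Real.Gamma ((1 - κ) / 2)
  set g4 := Real.Gamma κ
  have key : P * P * g3 * g4 * C = S * g1 := by
    have : (P * P * g3 * g4 * C) * (S * g2) = (S * g1) * (S * g2) := by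
      calc _ = (g4 * (P * P) * S) * (g2 * g3 * C) := by ring
        _ = g1 * g2 * Real.pi := by rw [← d, r]
        _ = _ := by rw [← hs]; ring
    exact mul_right_cancel₀ (by positivity) this
  field_simp
  linear_combination A * key

lemma sqrt_add_sub_sq {x r : ℝ} (hx : 0 ≤ x) (hr : 0 ≤ r) :
    (Real.sqrt (x + r) - Real.sqrt x) ^ 2 ≤ r := by
  have h1 := Real.sq_sqrt hx
  have h2 := Real.sq_sqrt (add_nonneg hx hr)
  have h3 := Real.sqrt_le_sqrt (le_add_of_nonneg_right hr : x ≤ x + r)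
  have h4 := Real.sqrt_nonneg x
  nlinarith

/-- Rescaled multiplier. -/
noncomputable def MM (β α γ μ t δ lam : ℝ) : ℝ :=
  mittagLeffler β (-(μ * |lam| ^ α * (1 + lam ^ 2 * δ ^ 2) ^ (γ / 2) * t ^ β))

lemma MM_nonneg {β α γ μ t : ℝ} (hβ : β ∈ Set.Ioo (0 : ℝ) 1) (hμ : 0 < μ) (ht : 0 < t)
    (δ lam : ℝ) : 0 ≤ MM β α γ μ t δ lam := ml_nonneg hβ (by positivity)

lemma MM_bound {β α γ μ t : ℝ} (hβ : β ∈ Set.Ioo (0 : ℝ) 1) (hγ : 0 < γ) (hμ : 0 < μ) (ht : 0 < t)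
    (δ lam : ℝ) :
    MM β α γ μ t δ lam ≤ (1 + μ * t ^ β / Real.Gamma (1 + β) * |lam| ^ α)⁻¹ := by
  have hG := Real.Gamma_pos_of_pos (s := 1 + β) (by linarith [hβ.1])
  have hM := MM_nonneg (α := α) (γ := γ) hβ hμ ht δ lam
  have h := ml_bound hβ (x := μ * |lam| ^ α * (1 + lam ^ 2 * δ ^ 2) ^ (γ / 2) * t ^ β)
    (by positivity)
  have h1 : (1 : ℝ) ≤ (1 + lam ^ 2 * δ ^ 2) ^ (γ / 2) :=
    Real.one_le_rpow (by nlinarith [mul_nonneg (sq_nonneg lam) (sq_nonneg δ)]) (by positivity)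
  rw [← one_div, le_div_iff₀ (by positivity)]
  refine le_trans (mul_le_mul_of_nonneg_left ?_ hM) h
  have h2 : μ * t ^ β * |lam| ^ α ≤ μ * |lam| ^ α * (1 + lam ^ 2 * δ ^ 2) ^ (γ / 2) * t ^ β := by
    have h3 : 0 ≤ μ * t ^ β * |lam| ^ α := by positivity
    nlinarith [mul_le_mul_of_nonneg_left h1 h3]
  rw [div_mul_eq_mul_div]
  gcongr

lemma MM_continuous {β α γ μ t : ℝ} (hβ : β ∈ Set.Ioo (0 : ℝ) 1) (hγ : 0 < γ) (lam : ℝ) :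
    Continuous fun δ => MM β α γ μ t δ lam := by
  unfold MM
  refine (ml_continuous hβ).comp ?_
  refine (((continuous_const.mul ?_).mul continuous_const)).neg
  exact Continuous.rpow_const (by fun_prop) fun x => Or.inr (by positivity)

lemma MM_measurable {β α γ μ t : ℝ} (hβ : β ∈ Set.Ioo (0 : ℝ) 1) (δ : ℝ) :
    Measurable (MM β α γ μ t δ) := by
  have := (ml_continuous hβ).measurable
  unfold MM
  fun_prop

lemma weight_bound {c α a lam : ℝ} (hc : 0 < c) (ha : 0 < a) (haα : a < 2 * α) (hl : lam ≠ 0) :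
    ((1 + c * |lam| ^ α)⁻¹) ^ 2 ≤ (c ^ (a / α))⁻¹ * |lam| ^ (-a) := by
  have hl' := abs_pos.2 hl
  have hα : 0 < α := by linarith
  set y := c * |lam| ^ α with hy
  have hy0 : 0 < y := by positivity
  have h1 : y ^ (a / (2 * α)) ≤ 1 + y := by
    rcases le_total y 1 with h | h
    · have := Real.rpow_le_one hy0.le h (z := a / (2 * α)) (by positivity)
      linarith
    · have := Real.rpow_le_rpow_of_exponent_le h (y := a / (2 * α)) (z := 1)
        (by rw [div_le_one (by positivity)]; exact haα.le)
      rw [Real.rpow_one] at this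
      linarith
  have h2 : (y ^ (a / (2 * α))) ^ 2 = c ^ (a / α) * |lam| ^ a := by
    rw [← Real.rpow_natCast, ← Real.rpow_mul hy0.le, hy, Real.mul_rpow hc.le (by positivity),
      ← Real.rpow_mul hl'.le]
    congr 2 <;> push_cast <;> field_simp
  rw [Real.rpow_neg hl'.le, ← mul_inv, ← h2, inv_pow]
  have : 0 < y ^ (a / (2 * α)) := by positivity
  gcongr

lemma weight_integrable {c α κ : ℝ} (hc : 0 < c) (hκ : κ ∈ Set.Ioo (0 : ℝ) 1) (hα : κ / 2 < α) :
    Integrable fun lam : ℝ => ((1 + c * |lam| ^ α)⁻¹) ^ 2 * |lam| ^ (κ - 1) := by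
  have hα0 : 0 < α := by linarith [hκ.1]
  refine ((bnd_integrable (a := κ - 1) (b := κ - 1 - 2 * α) (by linarith [hκ.1])
    (by linarith)).const_mul (1 + (c ^ 2)⁻¹)).mono'
    (by fun_prop : Measurable fun lam : ℝ =>
      ((1 + c * |lam| ^ α)⁻¹) ^ 2 * |lam| ^ (κ - 1)).aestronglyMeasurable
    (ae_of_all _ fun v => ?_)
  rw [Real.norm_of_nonneg (by positivity)]
  unfold bnd
  have hr : 0 ≤ |v| ^ (κ - 1) := by positivity
  have hc2 : 0 < (c ^ 2)⁻¹ := by positivity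
  have hv0 : 0 ≤ c * |v| ^ α := by positivity
  split_ifs with h
  · refine mul_le_mul_of_nonneg_right ?_ hr
    have : ((1 + c * |v| ^ α)⁻¹) ^ 2 ≤ 1 := pow_le_one₀ (by positivity) (inv_le_one_of_one_le₀ (by linarith))
    linarith
  · have hv : 0 < |v| := by linarith
    have hva : 0 < |v| ^ α := by positivity
    have e : |v| ^ (κ - 1 - 2 * α) = |v| ^ (κ - 1) * ((|v| ^ α) ^ 2)⁻¹ := by
      rw [Real.rpow_sub hv (κ - 1), div_eq_mul_inv, mul_comm 2 α, Real.rpow_mul hv.le, Real.rpow_two]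
    rw [e]
    have h1 : ((1 + c * |v| ^ α)⁻¹) ^ 2 ≤ (c ^ 2)⁻¹ * ((|v| ^ α) ^ 2)⁻¹ := by
      rw [← mul_inv, ← mul_pow, inv_pow]
      gcongr
      linarith
    calc ((1 + c * |v| ^ α)⁻¹) ^ 2 * |v| ^ (κ - 1)
        ≤ ((c ^ 2)⁻¹ * ((|v| ^ α) ^ 2)⁻¹) * |v| ^ (κ - 1) := by gcongr
      _ = (c ^ 2)⁻¹ * (|v| ^ (κ - 1) * ((|v| ^ α) ^ 2)⁻¹) := by ring
      _ ≤ _ := by gcongr; linarith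

lemma core_limit {κ β α γ μ t c0 : ℝ} {R : ℝ → ℝ} (hκ : κ ∈ Set.Ioo (0 : ℝ) 1)
    (hβ : β ∈ Set.Ioo (0 : ℝ) 1) (hα : κ / 2 < α) (hγ : 0 < γ) (hμ : 0 < μ) (ht : 0 < t)
    (hc0 : 0 ≤ c0) (hR : ∀ u, 0 ≤ R u)
    (hRi : ∀ a ∈ Set.Ioo (0 : ℝ) 1, Integrable fun u => |u| ^ (-a) * R u) :
    Tendsto (fun δ : ℝ => ∫ lam : ℝ,
        (MM β α γ μ t δ lam * δ ^ ((1 - κ) / 2) * Real.sqrt (c0 * gK κ (δ * lam) + R (δ * lam)) -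
          Real.sqrt (c0 * Real.Gamma ((1 - κ) / 2)) * mittagLeffler β (-(μ * t ^ β * |lam| ^ α)) *
            |lam| ^ ((κ - 1) / 2)) ^ 2) (𝓝[>] (0 : ℝ)) (𝓝 0) := by
  have hp : 0 < (1 - κ) / 2 := by linarith [hκ.2]
  have hα0 : 0 < α := by linarith [hκ.1]
  have hGp := Real.Gamma_pos_of_pos hp
  have hGβ := Real.Gamma_pos_of_pos (s := 1 + β) (by linarith [hβ.1])
  obtain ⟨a, ha1, ha2⟩ : ∃ a, κ < a ∧ a < min 1 (2 * α) :=
    exists_between (lt_min hκ.2 (by linarith))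
  have ha1' : a < 1 := ha2.trans_le (min_le_left _ _)
  have ha2' : a < 2 * α := ha2.trans_le (min_le_right _ _)
  have ha0 : 0 < a := hκ.1.trans ha1
  set c := μ * t ^ β / Real.Gamma (1 + β) with hc
  have hc' : 0 < c := by positivity
  set K := (c ^ (a / α))⁻¹ with hK
  have hK0 : 0 < K := by positivity
  set L : ℝ → ℝ := fun lam => Real.sqrt (c0 * Real.Gamma ((1 - κ) / 2)) *
    mittagLeffler β (-(μ * t ^ β * |lam| ^ α)) * |lam| ^ ((κ - 1) / 2) with hL
  set X : ℝ → ℝ → ℝ := fun δ lam => Real.sqrt (c0 * GK ((1 - κ) / 2) (δ * |lam|)) *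
    |lam| ^ ((κ - 1) / 2) with hX
  set S := Real.sqrt (c0 * Real.Gamma ((1 - κ) / 2)) with hS
  have hMn := fun δ lam => MM_nonneg (α := α) (γ := γ) hβ hμ ht δ lam
  have hMb := fun δ lam => MM_bound (α := α) hβ hγ hμ ht δ lam
  have hM0 : ∀ lam, MM β α γ μ t 0 lam = mittagLeffler β (-(μ * t ^ β * |lam| ^ α)) := by
    intro lam
    simp only [MM]
    congr 2
    norm_num
    ring
  -- the main part
  have hbound : ∀ δ lam, (MM β α γ μ t δ lam * X δ lam - L lam) ^ 2 ≤
      S ^ 2 * (((1 + c * |lam| ^ α)⁻¹) ^ 2 * |lam| ^ (κ - 1)) := by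
    intro δ lam
    have hN : 0 ≤ (1 + c * |lam| ^ α)⁻¹ := by positivity
    have hr : 0 ≤ |lam| ^ ((κ - 1) / 2) := by positivity
    have hS0 : 0 ≤ S := Real.sqrt_nonneg _
    have hX1 : X δ lam ≤ S * |lam| ^ ((κ - 1) / 2) := by
      refine mul_le_mul_of_nonneg_right (Real.sqrt_le_sqrt ?_) hr
      exact mul_le_mul_of_nonneg_left (GK_le hp _) hc0
    have hX0 : 0 ≤ X δ lam := mul_nonneg (Real.sqrt_nonneg _) hr
    have e : |lam| ^ (κ - 1) = (|lam| ^ ((κ - 1) / 2)) ^ 2 := by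
      rw [← Real.rpow_natCast, ← Real.rpow_mul (abs_nonneg _)]
      congr 1; push_cast; ring
    have e2 : S ^ 2 * (((1 + c * |lam| ^ α)⁻¹) ^ 2 * |lam| ^ (κ - 1)) =
      ((1 + c * |lam| ^ α)⁻¹ * (S * |lam| ^ ((κ - 1) / 2))) ^ 2 := by rw [e]; ring
    rw [e2]
    have h1 : MM β α γ μ t δ lam * X δ lam ≤
        (1 + c * |lam| ^ α)⁻¹ * (S * |lam| ^ ((κ - 1) / 2)) :=
      mul_le_mul (hMb δ lam) hX1 hX0 hN
    have h2 : L lam ≤ (1 + c * |lam| ^ α)⁻¹ * (S * |lam| ^ ((κ - 1) / 2)) := by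
      have : L lam = MM β α γ μ t 0 lam * (S * |lam| ^ ((κ - 1) / 2)) := by
        rw [hM0]; simp only [hL]; ring
      rw [this]
      exact mul_le_mul_of_nonneg_right (hMb 0 lam) (by positivity)
    have h3 : 0 ≤ MM β α γ μ t δ lam * X δ lam := mul_nonneg (hMn _ _) hX0
    have h4 : 0 ≤ L lam := by
      simp only [hL]
      rw [← hM0]
      have := hMn 0 lam
      positivity
    apply sq_le_sq'
    · linarith
    · linarith
  have hWi := (weight_integrable hc' hκ hα).const_mul (S ^ 2)
  have hmeas : ∀ δ, Measurable fun lam => (MM β α γ μ t δ lam * X δ lam - L lam) ^ 2 := by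
    intro δ
    have h1 := MM_measurable (α := α) (γ := γ) (μ := μ) (t := t) hβ δ
    have h2 := (ml_continuous hβ).measurable
    have h3 := (GK_continuous hp).measurable
    simp only [hX, hL]
    fun_prop
  have hi1 : ∀ δ, Integrable fun lam => (MM β α γ μ t δ lam * X δ lam - L lam) ^ 2 := by
    intro δ
    refine hWi.mono' (hmeas δ).aestronglyMeasurable (ae_of_all _ fun lam => ?_)
    rw [Real.norm_of_nonneg (sq_nonneg _)]
    exact hbound δ lam
  have hJ1 : Tendsto (fun δ => ∫ lam, (MM β α γ μ t δ lam * X δ lam - L lam) ^ 2)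
      (𝓝[>] (0 : ℝ)) (𝓝 0) := by
    have h := tendsto_integral_filter_of_dominated_convergence (l := 𝓝[>] (0 : ℝ))
      (F := fun δ lam => (MM β α γ μ t δ lam * X δ lam - L lam) ^ 2) (f := fun _ => (0 : ℝ))
      (μ := volume) _ (Eventually.of_forall fun δ => (hmeas δ).aestronglyMeasurable)
      (Eventually.of_forall fun δ => ae_of_all _ fun lam => ?_) hWi (ae_of_all _ fun lam => ?_)
    · simpa using h
    · rw [Real.norm_of_nonneg (sq_nonneg _)]
      exact hbound δ lam
    · have hcont : Continuous fun δ => (MM β α γ μ t δ lam * X δ lam - L lam) ^ 2 := by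
        have h1 := MM_continuous (α := α) (μ := μ) (t := t) hβ hγ lam
        have h3 := GK_continuous hp
        simp only [hX]
        fun_prop
      refine (hcont.tendsto' 0 0 ?_).mono_left nhdsWithin_le_nhds
      rw [hM0]
      simp only [hX, hL, zero_mul, GK_zero hp]
      ring
  -- the remainder
  have hHi := hRi a ⟨ha0, ha1'⟩
  set H : ℝ → ℝ := fun u => |u| ^ (-a) * R u with hH
  have hJ2 : Tendsto (fun δ : ℝ => 2 * K * δ ^ (a - κ) * ∫ u, H u) (𝓝[>] (0 : ℝ)) (𝓝 0) := by
    have h : Continuous fun δ : ℝ => 2 * K * δ ^ (a - κ) * ∫ u, H u := by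
      have : Continuous fun δ : ℝ => δ ^ (a - κ) :=
        continuous_id.rpow_const fun x => Or.inr (by linarith)
      fun_prop
    refine (h.tendsto' 0 0 ?_).mono_left nhdsWithin_le_nhds
    rw [Real.zero_rpow (by linarith)]
    ring
  have hsum := (hJ1.const_mul 2).add hJ2
  rw [mul_zero, add_zero] at hsum
  refine squeeze_zero' (Eventually.of_forall fun δ => integral_nonneg fun lam => sq_nonneg _) ?_ hsum
  filter_upwards [self_mem_nhdsWithin] with δ hδ
  have hδ0 : (0 : ℝ) < δ := hδ
  have hi2 : Integrable fun lam => 2 * K * δ ^ (a + 1 - κ) * H (δ * lam) :=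
    (hHi.comp_mul_left' hδ0.ne').const_mul _
  have hi3 := (hi1 δ).const_mul 2
  have e : 2 * (∫ lam, (MM β α γ μ t δ lam * X δ lam - L lam) ^ 2)
      + 2 * K * δ ^ (a - κ) * ∫ u, H u
      = ∫ lam, (2 * (MM β α γ μ t δ lam * X δ lam - L lam) ^ 2
        + 2 * K * δ ^ (a + 1 - κ) * H (δ * lam)) := by
    rw [integral_add hi3 hi2, integral_const_mul, integral_const_mul,
      Measure.integral_comp_mul_left, smul_eq_mul, abs_of_pos (inv_pos.2 hδ0),
      show a + 1 - κ = a - κ + 1 by ring, Real.rpow_add_one hδ0.ne']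
    field_simp
  rw [e]
  refine integral_mono_of_nonneg (ae_of_all _ fun lam => sq_nonneg _) (hi3.add hi2) ?_
  have h0 : ∀ᵐ x : ℝ, x ≠ 0 := by simp [ae_iff, measure_singleton]
  filter_upwards [h0] with lam hlam
  have hl := abs_pos.2 hlam
  set M := MM β α γ μ t δ lam with hM
  set D := δ ^ ((1 - κ) / 2) with hD
  have hD2 : D ^ 2 = δ ^ (1 - κ) := by
    rw [hD, ← Real.rpow_natCast, ← Real.rpow_mul hδ0.le]
    congr 1; push_cast; ring
  have hXe : X δ lam = D * Real.sqrt (c0 * gK κ (δ * lam)) := by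
    have h1 : c0 * gK κ (δ * lam) = (δ * |lam|) ^ (κ - 1) * (c0 * GK ((1 - κ) / 2) (δ * |lam|)) := by
      rw [gK, abs_mul, abs_of_pos hδ0]; ring
    have h2 : Real.sqrt ((δ * |lam|) ^ (κ - 1)) = δ ^ ((κ - 1) / 2) * |lam| ^ ((κ - 1) / 2) := by
      rw [Real.sqrt_eq_rpow, ← Real.rpow_mul (by positivity), Real.mul_rpow hδ0.le hl.le]
      ring_nf
    have h3 : D * δ ^ ((κ - 1) / 2) = 1 := by
      rw [hD, ← Real.rpow_add hδ0]
      rw [show (1 - κ) / 2 + (κ - 1) / 2 = 0 by ring, Real.rpow_zero]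
    rw [h1, Real.sqrt_mul (by positivity), h2]
    simp only [hX]
    linear_combination (-Real.sqrt (c0 * GK ((1 - κ) / 2) (δ * |lam|)) * |lam| ^ ((κ - 1) / 2)) * h3
  set Y := D * Real.sqrt (c0 * gK κ (δ * lam) + R (δ * lam)) with hY
  have hYX : (Y - X δ lam) ^ 2 ≤ δ ^ (1 - κ) * R (δ * lam) := by
    rw [hXe, hY, ← mul_sub, mul_pow, hD2]
    exact mul_le_mul_of_nonneg_left (sqrt_add_sub_sq (mul_nonneg hc0 (gK_nonneg _ _)) (hR _))
      (by positivity)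
  have hM2 : M ^ 2 ≤ K * |lam| ^ (-a) :=
    (pow_le_pow_left₀ (hMn δ lam) (hMb δ lam) 2).trans (weight_bound hc' ha0 ha2' hlam)
  have hprod : M ^ 2 * (Y - X δ lam) ^ 2 ≤ K * |lam| ^ (-a) * (δ ^ (1 - κ) * R (δ * lam)) :=
    mul_le_mul hM2 hYX (sq_nonneg _) (by positivity)
  have hHe : K * δ ^ (a + 1 - κ) * H (δ * lam)
      = K * |lam| ^ (-a) * (δ ^ (1 - κ) * R (δ * lam)) := by
    simp only [hH]
    rw [abs_mul, abs_of_pos hδ0, Real.mul_rpow hδ0.le hl.le]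
    have : δ ^ (a + 1 - κ) * δ ^ (-a) = δ ^ (1 - κ) := by
      rw [← Real.rpow_add hδ0]; congr 1; ring
    linear_combination (K * |lam| ^ (-a) * R (δ * lam)) * this
  have e5 : M * D * Real.sqrt (c0 * gK κ (δ * lam) + R (δ * lam)) = M * Y := by rw [hY]; ring
  rw [e5]
  change (M * Y - L lam) ^ 2 ≤ _
  nlinarith [sq_nonneg (M * X δ lam - L lam - M * (Y - X δ lam))]

lemma specDensity_eq (n : ℕ) (w κ A : ℕ → ℝ)
    (hκ : ∀ j ∈ Finset.range (n + 1), κ j ∈ Set.Ioo (0 : ℝ) 1) (u : ℝ) :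
    specDensity n w κ A u =
      2 * (2 : ℝ) ^ ((1 - κ 0) / 2) / (Real.sqrt Real.pi * Real.Gamma (κ 0 / 2)) / 2 * A 0 *
        ((2 : ℝ) ^ ((1 - κ 0) / 2) / 2) * gK (κ 0) u +
      ∑ j ∈ Finset.Icc 1 n,
        (2 : ℝ) ^ ((1 - κ j) / 2) / (Real.sqrt Real.pi * Real.Gamma (κ j / 2)) / 2 * A j *
        ((2 : ℝ) ^ ((1 - κ j) / 2) / 2) * (gK (κ j) (u + w j) + gK (κ j) (u + -w j)) := by
  unfold specDensity
  congr 1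
  · rw [mul_assoc _ (besselK _ _), bessel_term (hκ 0 (by simp))]
    ring
  · refine Finset.sum_congr rfl fun j hj => ?_
    have hj' : j ∈ Finset.range (n + 1) := by
      simp only [Finset.mem_Icc, Finset.mem_range] at hj ⊢; omega
    rw [bessel_term (hκ j hj'), bessel_term (hκ j hj'), ← sub_eq_add_neg]
    ring

theorem mean_square_limit_A0_pos (n : ℕ) (hn : 1 ≤ n) (w κ A : ℕ → ℝ)
    (hw0 : w 0 = 0) (hw : ∀ j ∈ Finset.Icc 1 n, 0 < w j)
    (hκ : ∀ j ∈ Finset.range (n + 1), κ j ∈ Set.Ioo (0 : ℝ) 1)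
    (hA : ∀ j ∈ Finset.range (n + 1), 0 ≤ A j)
    (hAsum : ∑ j ∈ Finset.range (n + 1), A j = 1) (hA0 : 0 < A 0)
    (β α γ μ t : ℝ) (hβ : β ∈ Set.Ioo (0 : ℝ) 1) (hα : κ 0 / 2 < α) (hγ : 0 < γ)
    (hμ : 0 < μ) (ht : 0 < t) :
    Filter.Tendsto
      (fun ε : ℝ =>
        ∫ lam : ℝ,
          (mittagLeffler β
              (-(μ * |lam| ^ α * (1 + lam ^ 2 * ε ^ (2 * β / α)) ^ (γ / 2) * t ^ β)) *
            ε ^ ((1 - κ 0) * β / (2 * α)) *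
            Real.sqrt (specDensity n w κ A (ε ^ (β / α) * lam)) -
          Real.sqrt (A 0 / (2 * Real.Gamma (κ 0) * Real.cos (Real.pi * κ 0 / 2))) *
            mittagLeffler β (-(μ * t ^ β * |lam| ^ α)) * |lam| ^ ((κ 0 - 1) / 2)) ^ 2)
      (𝓝[>] (0 : ℝ)) (𝓝 0) := by
  have hκ0 := hκ 0 (by simp)
  have hα0 : 0 < α := by linarith [hκ0.1]
  have hG0 := Real.Gamma_pos_of_pos (s := κ 0 / 2) (by linarith [hκ0.1])
  set R : ℝ → ℝ := fun u => ∑ j ∈ Finset.Icc 1 n,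
        (2 : ℝ) ^ ((1 - κ j) / 2) / (Real.sqrt Real.pi * Real.Gamma (κ j / 2)) / 2 * A j *
        ((2 : ℝ) ^ ((1 - κ j) / 2) / 2) * (gK (κ j) (u + w j) + gK (κ j) (u + -w j)) with hRdef
  have hmem : ∀ j ∈ Finset.Icc 1 n, j ∈ Finset.range (n + 1) := by
    intro j hj
    simp only [Finset.mem_Icc, Finset.mem_range] at hj ⊢; omega
  have hR : ∀ u, 0 ≤ R u := by
    intro u
    refine Finset.sum_nonneg fun j hj => ?_
    have h1 := Real.Gamma_pos_of_pos (s := κ j / 2) (by linarith [(hκ j (hmem j hj)).1])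
    have h2 := hA j (hmem j hj)
    have h3 := gK_nonneg (κ j) (u + w j)
    have h4 := gK_nonneg (κ j) (u + -w j)
    positivity
  have hRi : ∀ a ∈ Set.Ioo (0 : ℝ) 1, Integrable fun u => |u| ^ (-a) * R u := by
    intro a ha
    simp only [hRdef, Finset.mul_sum]
    refine integrable_finsetSum _ fun j hj => ?_
    have h1 := gK_weighted (hκ j (hmem j hj)) ha (hw j hj).ne'
    have h2 := gK_weighted (hκ j (hmem j hj)) ha (neg_ne_zero.2 (hw j hj).ne')
    refine ((h1.add h2).const_mul ((2 : ℝ) ^ ((1 - κ j) / 2) /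
      (Real.sqrt Real.pi * Real.Gamma (κ j / 2)) / 2 * A j *
        ((2 : ℝ) ^ ((1 - κ j) / 2) / 2))).congr (ae_of_all _ fun u => ?_)
    simp only [Pi.add_apply]
    ring
  have hc0 : 0 ≤ 2 * (2 : ℝ) ^ ((1 - κ 0) / 2) / (Real.sqrt Real.pi * Real.Gamma (κ 0 / 2)) / 2 *
      A 0 * ((2 : ℝ) ^ ((1 - κ 0) / 2) / 2) := by positivity
  have hcore := core_limit hκ0 hβ hα hγ hμ ht hc0 hR hRi
  rw [const_eq hκ0] at hcore
  have hpos : 0 < β / α := div_pos hβ.1 hα0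
  have hδ : Tendsto (fun ε : ℝ => ε ^ (β / α)) (𝓝[>] (0 : ℝ)) (𝓝[>] (0 : ℝ)) := by
    refine tendsto_nhdsWithin_iff.2 ⟨?_, ?_⟩
    · have hcont : Continuous fun ε : ℝ => ε ^ (β / α) :=
        continuous_id.rpow_const fun x => Or.inr hpos.le
      exact (hcont.tendsto' 0 0 (Real.zero_rpow hpos.ne')).mono_left nhdsWithin_le_nhds
    · filter_upwards [self_mem_nhdsWithin] with ε hε
      exact Real.rpow_pos_of_pos hε _
  refine (hcore.comp hδ).congr' ?_
  filter_upwards [self_mem_nhdsWithin] with ε hε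
  have hε0 : (0 : ℝ) < ε := hε
  have e1 : (ε ^ (β / α)) ^ 2 = ε ^ (2 * β / α) := by
    rw [← Real.rpow_natCast, ← Real.rpow_mul hε0.le]
    congr 1; push_cast; ring
  have e2 : (ε ^ (β / α)) ^ ((1 - κ 0) / 2) = ε ^ ((1 - κ 0) * β / (2 * α)) := by
    rw [← Real.rpow_mul hε0.le]
    congr 1; field_simp
  simp only [Function.comp_apply, MM, e1, e2, specDensity_eq n w κ A hκ, hRdef]
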